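/- Let v be a place of K and set M_v := max{1, max_{0≤i≤d−1} |a_i|_v^{1/(q^d − q^i)}}. If x ∈ K satisfies ĥ_v(x) = 0, then |Φ_Q(x)|_v ≤ M_v for every polynomial Q ∈ F_q[t]; in particular |x|_v ≤ M_v. -/

import Mathlib

open Polynomial Filter Topology

/-- A family of nonarchimedean places on a field `K`, with absolute values normalized so that
every nonzero `x` satisfies `|x|_v = 1` for all but finitely many places and the product
formula holds. -/
structure PlaceFamily (K : Type) [Field K] where
  Places : Type
  absv : Places → AbsoluteValue K ℝ
  nonarch : ∀ (v : Places) (x y : K), absv v (x + y) ≤ max (absv v x) (absv v y)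
  finite_ne_one : ∀ x : K, x ≠ 0 → {v : Places | absv v x ≠ 1}.Finite
  product_formula : ∀ x : K, x ≠ 0 → ∏ᶠ v : Places, absv v x = 1

/-- A Drinfeld module of generic characteristic over `K`: an `𝔽_q`-algebra homomorphism
`Φ : 𝔽_q[t] → K{τ}`, where an element `Σ b_i τ^i` of the twisted polynomial ring `K{τ}` is
recorded as the additive polynomial `Σ b_i X^{q^i} ∈ K[X]` (composition of polynomials
corresponding to multiplication in `K{τ}`); the coefficient of `τ^0` in `Φ_a` equals `a`
(via the embedding `𝔽_q[t] → K`), and `Φ_t ≠ t·τ^0`. -/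
structure DrinfeldModule (Fq K : Type) [Field Fq] [Fintype Fq] [Field K]
    [Algebra (Polynomial Fq) K] where
  toFun : Polynomial Fq → Polynomial K
  map_add' : ∀ a b : Polynomial Fq, toFun (a + b) = toFun a + toFun b
  map_mul' : ∀ a b : Polynomial Fq, toFun (a * b) = (toFun a).comp (toFun b)
  map_C' : ∀ c : Fq, toFun (Polynomial.C c) =
    Polynomial.C (algebraMap (Polynomial Fq) K (Polynomial.C c)) * Polynomial.X
  coeff_one' : ∀ a : Polynomial Fq, (toFun a).coeff 1 = algebraMap (Polynomial Fq) K a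
  support_pow' : ∀ (a : Polynomial Fq) (n : ℕ), (toFun a).coeff n ≠ 0 →
    ∃ i : ℕ, n = (Fintype.card Fq) ^ i
  generic' : toFun Polynomial.X ≠
    Polynomial.C (algebraMap (Polynomial Fq) K Polynomial.X) * Polynomial.X

namespace DrinfeldModule

variable {Fq K : Type} [Field Fq] [Fintype Fq] [Field K] [Algebra (Polynomial Fq) K]

/-- The action `Φ_a(x)` of `a ∈ 𝔽_q[t]` on `x ∈ 𝔾_a(K)` induced by the Drinfeld module. -/
noncomputable def act (Φ : DrinfeldModule Fq K) (a : Polynomial Fq) (x : K) : K :=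
  (Φ.toFun a).eval x

/-- `Φ` has rank `d ≥ 1`, i.e. `Φ_t = Σ_{i=0}^d a_i τ^i` with `a_d ≠ 0`. -/
def HasRank (Φ : DrinfeldModule Fq K) (d : ℕ) : Prop :=
  1 ≤ d ∧ (Φ.toFun Polynomial.X).natDegree = (Fintype.card Fq) ^ d

/-- `x` is a torsion point for `Φ`. -/
def IsTorsion (Φ : DrinfeldModule Fq K) (x : K) : Prop :=
  ∃ Q : Polynomial Fq, Q ≠ 0 ∧ Φ.act Q x = 0

/-- `hv` is the local canonical height attached to `Φ` (of rank `d`) at the place `v`: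
`ĥ_v(x) = lim_{n→∞} log max(|Φ_{t^n}(x)|_v, 1) / q^{nd}`. -/
def IsLocalHeight (Φ : DrinfeldModule Fq K) (d : ℕ) (v : AbsoluteValue K ℝ)
    (hv : K → ℝ) : Prop :=
  ∀ x : K, Tendsto
    (fun n : ℕ => Real.log (max (v (Φ.act (Polynomial.X ^ n) x)) 1) /
      (Fintype.card Fq : ℝ) ^ (n * d)) atTop (𝓝 (hv x))

end DrinfeldModule

/-- The Weil height `h(x) = Σ_v log max(|x|_v, 1)`. -/
noncomputable def weilHeight {K : Type} [Field K] (P : PlaceFamily K) (x : K) : ℝ :=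
  ∑ᶠ v : P.Places, Real.log (max (P.absv v x) 1)

/-- `hh` is the (global) canonical height attached to `Φ` of rank `d`:
`ĥ(x) = lim_{n→∞} h(Φ_{t^n}(x)) / q^{nd}`. -/
def DrinfeldModule.IsCanonicalHeight {Fq K : Type} [Field Fq] [Fintype Fq] [Field K]
    [Algebra (Polynomial Fq) K] (Φ : DrinfeldModule Fq K) (P : PlaceFamily K)
    (d : ℕ) (hh : K → ℝ) : Prop :=
  ∀ x : K, Tendsto
    (fun n : ℕ => weilHeight P (Φ.act (Polynomial.X ^ n) x) /
      (Fintype.card Fq : ℝ) ^ (n * d)) atTop (𝓝 (hh x))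

/-- `β` is `S`-integral with respect to `α`. -/
def SIntegral {K : Type} [Field K] (P : PlaceFamily K) (S : Set P.Places) (α β : K) : Prop :=
  ∀ v : P.Places, v ∉ S →
    (P.absv v α ≤ 1 → 1 ≤ P.absv v (α - β)) ∧
    (1 < P.absv v α → P.absv v β ≤ 1)

/-- `Γ` is a finitely generated `Φ`-submodule: it is generated, as an `A`-module under the
action `a · x = Φ_a(x)`, by finitely many elements. -/
def DrinfeldModule.FinGen {Fq K : Type} [Field Fq] [Fintype Fq] [Field K]
    [Algebra (Polynomial Fq) K] (Φ : DrinfeldModule Fq K) (Γ : AddSubgroup K) : Prop :=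
  ∃ s : Finset K, ∀ x : K, x ∈ Γ ↔ ∃ c : K → Polynomial Fq, x = ∑ g ∈ s, Φ.act (c g) g

open scoped Classical in
/-- `q^{d·deg P}`, with the convention that it equals `0` for the zero polynomial. -/
noncomputable def qdeg {Fq : Type} [Field Fq] [Fintype Fq] (d : ℕ) (P : Polynomial Fq) : ℝ :=
  if P = 0 then 0 else (Fintype.card Fq : ℝ) ^ (d * P.natDegree)

namespace DrinfeldModule

variable {Fq K : Type} [Field Fq] [Fintype Fq] [Field K] [Algebra (Polynomial Fq) K]

theorem act_add (Φ : DrinfeldModule Fq K) (a b : Polynomial Fq) (x : K) :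
    Φ.act (a + b) x = Φ.act a x + Φ.act b x := by
  simp [act, Φ.map_add']

theorem act_mul (Φ : DrinfeldModule Fq K) (a b : Polynomial Fq) (x : K) :
    Φ.act (a * b) x = Φ.act a (Φ.act b x) := by
  simp [act, Φ.map_mul']

theorem act_C (Φ : DrinfeldModule Fq K) (c : Fq) (x : K) :
    Φ.act (C c) x = algebraMap (Polynomial Fq) K (C c) * x := by
  simp [act, Φ.map_C']

theorem act_one (Φ : DrinfeldModule Fq K) (x : K) : Φ.act 1 x = x := by
  simpa using Φ.act_C 1 x

end DrinfeldModule

/-- Constants from the finite field have absolute value at most one. -/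
theorem absoluteValue_algebraMap_C_le_one {Fq K : Type} [Field Fq] [Fintype Fq] [Field K]
    [Algebra (Polynomial Fq) K] (v : AbsoluteValue K ℝ) (c : Fq) :
    v (algebraMap (Polynomial Fq) K (C c)) ≤ 1 := by
  by_contra! h
  have hpow : v (algebraMap (Polynomial Fq) K (C c)) ^ Fintype.card Fq =
      v (algebraMap (Polynomial Fq) K (C c)) := by
    rw [← map_pow, ← map_pow, ← C_pow, FiniteField.pow_card]
  exact absurd hpow (lt_self_pow₀ h Fintype.one_lt_card).ne'

namespace DrinfeldModule

variable {Fq K : Type} [Field Fq] [Fintype Fq] [Field K] [Algebra (Polynomial Fq) K]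

/-- If each lower coefficient satisfies `|a_i| < |y|^{q^d - q^i}`, the leading term of `Φ_t(y)`
dominates. -/
theorem absoluteValue_act_X_of_coeff_lt (Φ : DrinfeldModule Fq K) {d : ℕ} (hrank : Φ.HasRank d)
    (hmonic : (Φ.toFun X).Monic) (v : AbsoluteValue K ℝ)
    (hnonarch : IsNonarchimedean v) {y : K} (hy : 0 < v y)
    (hcoeff : ∀ i < d, v ((Φ.toFun X).coeff (Fintype.card Fq ^ i)) * v y ^ Fintype.card Fq ^ i <
      v y ^ Fintype.card Fq ^ d) :
    v (Φ.act X y) = v y ^ Fintype.card Fq ^ d := by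
  have hlower : v ((Φ.toFun X).eraseLead.eval y) < v (y ^ Fintype.card Fq ^ d) := by
    rw [eval_eq_sum, Polynomial.sum]
    refine Finset.sum_induction _ (fun z => v z < v (y ^ Fintype.card Fq ^ d)) ?_ ?_ ?_
    · exact fun a b ha hb => (hnonarch a b).trans_lt (max_lt ha hb)
    · simpa using pow_pos hy _
    · intro n hn
      have hlt : n < (Φ.toFun X).natDegree := lt_natDegree_of_mem_eraseLead_support hn
      have hne : (Φ.toFun X).coeff n ≠ 0 := by
        rw [mem_support_iff, eraseLead_coeff_of_ne _ hlt.ne] at hn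
        exact hn
      obtain ⟨i, rfl⟩ := Φ.support_pow' X n hne
      rw [eraseLead_coeff_of_ne _ hlt.ne, map_mul, map_pow, map_pow]
      rw [hrank.2] at hlt
      exact hcoeff i ((Nat.pow_lt_pow_iff_right Fintype.one_lt_card).mp hlt)
  have hsplit : Φ.act X y = (Φ.toFun X).eraseLead.eval y + y ^ Fintype.card Fq ^ d := by
    conv_lhs => rw [act, ← eraseLead_add_C_mul_X_pow (Φ.toFun X)]
    simp [hmonic.leadingCoeff, hrank.2]
  rw [hsplit, hnonarch.add_eq_max_of_ne hlower.ne, max_eq_right hlower.le, map_pow]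

/-- If `Φ_t` raises absolute values above `M ≥ 1` to the power `q^d`, then so do its iterates. -/
theorem absoluteValue_act_X_pow (Φ : DrinfeldModule Fq K) {d : ℕ} (v : AbsoluteValue K ℝ) {M : ℝ}
    (hM : 1 ≤ M) (hstep : ∀ y, M < v y → v (Φ.act X y) = v y ^ Fintype.card Fq ^ d)
    {y : K} (hy : M < v y) (n : ℕ) :
    v (Φ.act (X ^ n) y) = v y ^ Fintype.card Fq ^ (n * d) := by
  induction n with
  | zero => simp [act_one]
  | succ n ih =>
    have hlt : M < v (Φ.act (X ^ n) y) := by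
      rw [ih]
      exact hy.trans_le (le_self_pow₀ (hM.trans hy.le) (pow_ne_zero _ Fintype.card_ne_zero))
    rw [pow_succ', act_mul, hstep _ hlt, ih, ← pow_mul, ← pow_add, Nat.succ_mul]

/-- If the local height of `x` vanishes, the `Φ_t`-orbit of `x` never leaves the disc outside
which `Φ_t` raises absolute values to the power `q^d`. -/
theorem absoluteValue_act_X_pow_le_of_localHeight_eq_zero (Φ : DrinfeldModule Fq K) {d : ℕ}
    (v : AbsoluteValue K ℝ) {hv : K → ℝ} (hloc : Φ.IsLocalHeight d v hv) {M : ℝ} (hM : 1 ≤ M)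
    (hstep : ∀ y, M < v y → v (Φ.act X y) = v y ^ Fintype.card Fq ^ d)
    {x : K} (hx : hv x = 0) (n : ℕ) : v (Φ.act (X ^ n) x) ≤ M := by
  by_contra! h
  have hone : 1 < v (Φ.act (X ^ n) x) := hM.trans_lt h
  have hq : (0 : ℝ) < Fintype.card Fq := by exact_mod_cast Fintype.card_pos
  have hlim := (tendsto_add_atTop_iff_nat n).mpr (hloc x)
  have hconst : ∀ m : ℕ, Real.log (max (v (Φ.act (X ^ (m + n)) x)) 1) /
      (Fintype.card Fq : ℝ) ^ ((m + n) * d) =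
      Real.log (v (Φ.act (X ^ n) x)) / (Fintype.card Fq : ℝ) ^ (n * d) := by
    intro m
    rw [pow_add, act_mul, Φ.absoluteValue_act_X_pow v hM hstep h m,
      max_eq_left (one_le_pow₀ hone.le), Real.log_pow, add_mul, pow_add]
    push_cast
    field_simp
  simp only [hconst, hx] at hlim
  have hzero := tendsto_nhds_unique hlim tendsto_const_nhds
  exact absurd hzero.symm (div_pos (Real.log_pos hone) (pow_pos hq _)).ne'

end DrinfeldModule

/-- **Lemma.** Let `v` be a place of `K` and set
`M_v := max{1, max_{0 ≤ i ≤ d−1} |a_i|_v^{1/(q^d − q^i)}}`. If `x ∈ K` satisfies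
`ĥ_v(x) = 0`, then `|Φ_Q(x)|_v ≤ M_v` for every polynomial `Q ∈ 𝔽_q[t]`; in particular
`|x|_v ≤ M_v`. -/
theorem bounded_of_local_height_zero
    {Fq K : Type} [Field Fq] [Fintype Fq] [Field K]
    [Algebra (Polynomial Fq) K] [Algebra (RatFunc Fq) K]
    [IsScalarTower (Polynomial Fq) (RatFunc Fq) K] [FiniteDimensional (RatFunc Fq) K]
    (Φ : DrinfeldModule Fq K) (d : ℕ) (hrank : Φ.HasRank d)
    (hmonic : (Φ.toFun Polynomial.X).Monic)
    (v : AbsoluteValue K ℝ) (hnonarch : ∀ x y : K, v (x + y) ≤ max (v x) (v y))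
    (hv : K → ℝ) (hloc : Φ.IsLocalHeight d v hv)
    (Mv : ℝ)
    (hMv : Mv = max 1 ((Finset.range d).sup'
      (Finset.nonempty_range_iff.mpr (Nat.one_le_iff_ne_zero.mp hrank.1))
      (fun i => v ((Φ.toFun Polynomial.X).coeff ((Fintype.card Fq) ^ i)) ^
        (((Fintype.card Fq : ℝ) ^ d - (Fintype.card Fq : ℝ) ^ i)⁻¹))))
    (x : K) (hx : hv x = 0) :
    (∀ Q : Polynomial Fq, v (Φ.act Q x) ≤ Mv) ∧ v x ≤ Mv := by
  have hM : 1 ≤ Mv := hMv ▸ le_max_left _ _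
  have hstep : ∀ y, Mv < v y → v (Φ.act X y) = v y ^ Fintype.card Fq ^ d := by
    intro y hy
    have hy0 : 0 < v y := zero_lt_one.trans_le (hM.trans hy.le)
    refine Φ.absoluteValue_act_X_of_coeff_lt hrank hmonic v hnonarch hy0 fun i hi => ?_
    have hcard : (1 : ℝ) < Fintype.card Fq := by exact_mod_cast Fintype.one_lt_card
    have hexp : 0 < (Fintype.card Fq : ℝ) ^ d - (Fintype.card Fq : ℝ) ^ i :=
      sub_pos.mpr (pow_lt_pow_right₀ hcard hi)
    have hroot : v ((Φ.toFun X).coeff (Fintype.card Fq ^ i)) ^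
        (((Fintype.card Fq : ℝ) ^ d - (Fintype.card Fq : ℝ) ^ i)⁻¹) < v y := by
      refine lt_of_le_of_lt ?_ hy
      rw [hMv]
      exact le_max_of_le_right (Finset.le_sup' (fun i =>
        v ((Φ.toFun X).coeff (Fintype.card Fq ^ i)) ^
          (((Fintype.card Fq : ℝ) ^ d - (Fintype.card Fq : ℝ) ^ i)⁻¹)) (Finset.mem_range.mpr hi))
    rw [Real.rpow_inv_lt_iff_of_pos (v.nonneg _) hy0.le hexp, Real.rpow_sub hy0,
      lt_div_iff₀ (Real.rpow_pos_of_pos hy0 _)] at hroot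
    exact_mod_cast hroot
  have horbit := Φ.absoluteValue_act_X_pow_le_of_localHeight_eq_zero v hloc hM hstep hx
  refine ⟨fun Q => ?_, by simpa [DrinfeldModule.act_one] using horbit 0⟩
  induction Q using Polynomial.induction_on' with
  | add P Q hP hQ =>
    rw [Φ.act_add]
    exact (hnonarch _ _).trans (max_le hP hQ)
  | monomial n c =>
    rw [← C_mul_X_pow_eq_monomial, Φ.act_mul, Φ.act_C, map_mul]
    exact (mul_le_of_le_one_left (v.nonneg _) (absoluteValue_algebraMap_C_le_one v c)).trans
      (horbit n)
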